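/- Let μ be a finite shift-invariant Borel measure on Ω±. Then μ({ω ∈ Ω± : ω is not unbounded-collapsible}) = 2·μ({ω^alt}), where ω^alt ∈ Ω± is defined by ω^alt_n = (−1)ⁿ. -/

import Mathlib

open MeasureTheory

/-- `Ω± = {1,−1}^ℤ` (signs modeled by `ℤˣ`), with the product σ-algebra. -/
abbrev Om : Type := ℤ → ℤˣ

/-- The shift map `σ : Ω± → Ω±`, `σ(ω)_n = ω_{n+1}`. -/
def shiftMap (ω : Om) : Om := fun n => ω (n + 1)

/-- `K(ω) = {n : ¬(ω_n = −1 ∧ ω_{n+1} = 1) ∧ ¬(ω_{n−1} = −1 ∧ ω_n = 1)}`. -/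
def Kset (ω : Om) : Set ℤ :=
  {n : ℤ | ¬(ω n = -1 ∧ ω (n+1) = 1) ∧ ¬(ω (n-1) = -1 ∧ ω n = 1)}

/-- `ω` is unbounded-collapsible if `K(ω)` has neither an upper nor a lower bound. -/
def UnboundedCollapsible (ω : Om) : Prop :=
  ¬BddAbove (Kset ω) ∧ ¬BddBelow (Kset ω)

/-- The alternating sequence `ω^alt`, `ω^alt_n = (−1)ⁿ`. -/
def omAlt : Om := fun n => (-1 : ℤˣ) ^ n

/-- The sequences that alternate in sign at every position of `s`. -/
def alternatesOn (s : Set ℤ) : Set Om := {ω | ∀ n ∈ s, ω (n + 1) = -ω n}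

theorem units_int_one_ne_neg_one : (1 : ℤˣ) ≠ -1 := by decide

theorem measurableSet_alternatesOn (s : Set ℤ) : MeasurableSet (alternatesOn s) := by
  have : alternatesOn s = ⋂ n : ℤ, ⋂ _ : n ∈ s,
      (fun ω : Om => (((ω (n + 1) : ℤˣ) : ℤ), ((ω n : ℤˣ) : ℤ))) ⁻¹' {p | p.1 = -p.2} := by
    ext ω
    simp [alternatesOn, Units.ext_iff]
  rw [this]
  have hval : Measurable (Units.val : ℤˣ → ℤ) := comap_measurable _
  refine MeasurableSet.iInter fun n => MeasurableSet.iInter fun _ => ?_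
  exact ((hval.comp (measurable_pi_apply (n + 1))).prodMk
    (hval.comp (measurable_pi_apply n))) (Set.to_countable _).measurableSet

theorem alternatesOn_anti {s t : Set ℤ} (h : s ⊆ t) : alternatesOn t ⊆ alternatesOn s :=
  fun _ hω n hn => hω n (h hn)

theorem shiftMap_preimage_alternatesOn (s : Set ℤ) :
    shiftMap ⁻¹' alternatesOn s = alternatesOn {n | n - 1 ∈ s} := by
  ext ω
  simp only [alternatesOn, shiftMap, Set.mem_preimage, Set.mem_ofPred_eq]
  constructor
  · intro h n hn
    simpa using h (n - 1) hn
  · intro h n hn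
    exact h (n + 1) (by simpa using hn)

theorem bddAbove_Kset_iff (ω : Om) :
    BddAbove (Kset ω) ↔ ∃ N, ω ∈ alternatesOn (Set.Ici N) := by
  have h1 := units_int_one_ne_neg_one
  constructor
  · rintro ⟨N, hN⟩
    refine ⟨N + 1, fun n hn => ?_⟩
    have hn' : N + 1 ≤ n := hn
    have key : ∀ m, N < m → m ∉ Kset ω := fun m hm hmem => absurd (hN hmem) (by omega)
    have a := key n (by omega)
    have b := key (n + 1) (by omega)
    simp only [Kset, Set.mem_ofPred_eq, add_sub_cancel_right] at a b
    rcases Int.units_eq_one_or (ω n) with h | h <;>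
      rcases Int.units_eq_one_or (ω (n + 1)) with h' | h' <;> simp_all
  · rintro ⟨N, hN⟩
    refine ⟨N, fun n hn => ?_⟩
    by_contra! hlt
    have a := hN n (Set.mem_Ici.2 (by omega))
    have b := hN (n - 1) (Set.mem_Ici.2 (by omega))
    simp only [Kset, Set.mem_ofPred_eq] at hn
    rw [sub_add_cancel] at b
    rcases Int.units_eq_one_or (ω (n - 1)) with h | h <;> simp_all

theorem bddBelow_Kset_iff (ω : Om) :
    BddBelow (Kset ω) ↔ ∃ N, ω ∈ alternatesOn (Set.Iic N) := by
  have h1 := units_int_one_ne_neg_one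
  constructor
  · rintro ⟨N, hN⟩
    refine ⟨N - 2, fun n hn => ?_⟩
    have hn' : n ≤ N - 2 := hn
    have key : ∀ m, m < N → m ∉ Kset ω := fun m hm hmem => absurd (hN hmem) (by omega)
    have a := key n (by omega)
    have b := key (n + 1) (by omega)
    simp only [Kset, Set.mem_ofPred_eq, add_sub_cancel_right] at a b
    rcases Int.units_eq_one_or (ω n) with h | h <;>
      rcases Int.units_eq_one_or (ω (n + 1)) with h' | h' <;> simp_all
  · rintro ⟨N, hN⟩
    refine ⟨N, fun n hn => ?_⟩
    by_contra! hlt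
    have a := hN n (Set.mem_Iic.2 (by omega))
    have b := hN (n - 1) (Set.mem_Iic.2 (by omega))
    simp only [Kset, Set.mem_ofPred_eq] at hn
    rw [sub_add_cancel] at b
    rcases Int.units_eq_one_or (ω (n - 1)) with h | h <;> simp_all

theorem alternatesOn_univ : alternatesOn Set.univ = {omAlt, -omAlt} := by
  ext ω
  simp only [Set.mem_insert_iff, Set.mem_singleton_iff]
  constructor
  · intro h
    have key : ∀ n : ℤ, ω n = omAlt n * ω 0 := by
      intro n
      induction n using Int.induction_on with
      | zero => simp [omAlt]
      | succ i ih => rw [h _ trivial, ih]; simp [omAlt, zpow_add]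
      | pred i ih =>
        have := h (-(i : ℤ) - 1) trivial
        rw [sub_add_cancel, ih] at this
        rw [← neg_eq_iff_eq_neg] at this
        rw [← this]
        simp [omAlt, zpow_sub]
    rcases Int.units_eq_one_or (ω 0) with h0 | h0
    · exact Or.inl (funext fun n => by simp [key n, h0])
    · exact Or.inr (funext fun n => by simp [key n, h0])
  · rintro (rfl | rfl) n - <;> simp [omAlt, zpow_add]

theorem shiftMap_preimage_omAlt : shiftMap ⁻¹' {omAlt} = {-omAlt} := by
  ext ω
  simp only [Set.mem_preimage, Set.mem_singleton_iff]
  constructor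
  · intro h
    funext n
    have := congrFun h (n - 1)
    simp only [shiftMap, sub_add_cancel] at this
    rw [this]
    simp [omAlt, zpow_sub]
  · rintro rfl
    funext n
    simp [omAlt, shiftMap, zpow_add]

instance : MeasurableSingletonClass ℤˣ where
  measurableSet_singleton u :=
    ⟨{(u : ℤ)}, measurableSet_singleton _, by ext v; simp [Units.ext_iff]⟩

theorem omAlt_ne_neg : omAlt ≠ -omAlt := fun h =>
  units_int_one_ne_neg_one (by simpa [omAlt] using congrFun h 0)

theorem measure_alternatesOn_univ (μ : Measure Om)
    (hμ : ∀ A : Set Om, MeasurableSet A → μ (shiftMap ⁻¹' A) = μ A) :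
    μ (alternatesOn Set.univ) = 2 * μ {omAlt} := by
  rw [alternatesOn_univ, Set.insert_eq, measure_union (by simpa using omAlt_ne_neg)
    (measurableSet_singleton _), ← shiftMap_preimage_omAlt, hμ _ (measurableSet_singleton _),
    two_mul]

theorem ae_alternatesOn_of_subset (μ : Measure Om) [IsFiniteMeasure μ] {s t : Set ℤ}
    (hst : s ⊆ t) (h : μ (alternatesOn s) = μ (alternatesOn t)) :
    ∀ᵐ ω ∂μ, ω ∈ alternatesOn s → ω ∈ alternatesOn t :=
  (ae_eq_of_subset_of_measure_ge (alternatesOn_anti hst) h.le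
    (measurableSet_alternatesOn t).nullMeasurableSet (measure_ne_top _ _)).symm.le

theorem ae_alternatesOn_univ_of_Ici (μ : Measure Om) [IsFiniteMeasure μ]
    (hμ : ∀ A : Set Om, MeasurableSet A → μ (shiftMap ⁻¹' A) = μ A) :
    ∀ᵐ ω ∂μ, ∀ N, ω ∈ alternatesOn (Set.Ici N) → ω ∈ alternatesOn Set.univ := by
  have step : ∀ᵐ ω ∂μ, ∀ N : ℤ,
      ω ∈ alternatesOn (Set.Ici (N + 1)) → ω ∈ alternatesOn (Set.Ici N) := by
    refine ae_all_iff.2 fun N =>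
      ae_alternatesOn_of_subset μ (Set.Ici_subset_Ici.2 (by omega)) ?_
    rw [← hμ _ (measurableSet_alternatesOn (Set.Ici N)), shiftMap_preimage_alternatesOn]
    congr 2
    ext n
    simp only [Set.mem_Ici, Set.mem_ofPred_eq]
    omega
  filter_upwards [step] with ω hω N hN n _
  have key : ∀ k : ℕ, ω ∈ alternatesOn (Set.Ici (N - k)) := by
    intro k
    induction k with
    | zero => simpa using hN
    | succ k ih =>
      apply hω
      convert ih using 3
      push_cast
      ring
  exact key (N - n).toNat n (Set.mem_Ici.2 (by omega))

theorem ae_alternatesOn_univ_of_Iic (μ : Measure Om) [IsFiniteMeasure μ]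
    (hμ : ∀ A : Set Om, MeasurableSet A → μ (shiftMap ⁻¹' A) = μ A) :
    ∀ᵐ ω ∂μ, ∀ N, ω ∈ alternatesOn (Set.Iic N) → ω ∈ alternatesOn Set.univ := by
  have step : ∀ᵐ ω ∂μ, ∀ N : ℤ,
      ω ∈ alternatesOn (Set.Iic N) → ω ∈ alternatesOn (Set.Iic (N + 1)) := by
    refine ae_all_iff.2 fun N =>
      ae_alternatesOn_of_subset μ (Set.Iic_subset_Iic.2 (by omega)) ?_
    rw [← hμ _ (measurableSet_alternatesOn (Set.Iic N)), shiftMap_preimage_alternatesOn]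
    congr 2
    ext n
    simp only [Set.mem_Iic, Set.mem_ofPred_eq]
    omega
  filter_upwards [step] with ω hω N hN n _
  have key : ∀ k : ℕ, ω ∈ alternatesOn (Set.Iic (N + k)) := by
    intro k
    induction k with
    | zero => simpa using hN
    | succ k ih =>
      convert hω _ ih using 3
      push_cast
      ring
  exact key (n - N).toNat n (Set.mem_Iic.2 (by omega))

/-- Theorem 5.2 (4). For every finite shift-invariant Borel measure
`μ` on `Ω±`, the set of non-unbounded-collapsible sequences has measure `2·μ({ω^alt})`. -/
theorem measure_not_unbounded_collapsible (μ : Measure Om) [IsFiniteMeasure μ]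
    (hμ : ∀ A : Set Om, MeasurableSet A → μ (shiftMap ⁻¹' A) = μ A) :
    μ {ω : Om | ¬ UnboundedCollapsible ω} = 2 * μ {omAlt} := by
  rw [← measure_alternatesOn_univ μ hμ]
  refine measure_congr ?_
  filter_upwards [ae_alternatesOn_univ_of_Ici μ hμ, ae_alternatesOn_univ_of_Iic μ hμ]
    with ω hIci hIic
  refine propext ?_
  change ¬ UnboundedCollapsible ω ↔ ω ∈ alternatesOn Set.univ
  rw [UnboundedCollapsible, ← not_or, not_not, bddAbove_Kset_iff, bddBelow_Kset_iff]
  constructor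
  · rintro (⟨N, hN⟩ | ⟨N, hN⟩)
    exacts [hIci N hN, hIic N hN]
  · exact fun h => Or.inl ⟨0, alternatesOn_anti (Set.subset_univ _) h⟩
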